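/- Let (α_n), (β_n), (γ_n), n = 0, 1, 2, ..., be non-negative real numbers, let Δt > 0, σ > 0, τ ≥ 0, and suppose that for every n ≥ 0 the inequality (1 − σΔt) α_{n+1} + β_{n+1} ≤ (1 + τΔt) α_n + γ_{n+1} holds. Assume moreover that σΔt ≤ 1 − δ for some δ > 0. Then, setting ρ = (σ + τ)/δ and t_n = nΔt, for every n ≥ 1 one has Σ_{l=1}^{n} β_l ≤ (1 + τ/σ + (σ + τ) e^{ρ t_{n−1}} t_{n−1}) α_0 + (1/δ)(1 + (σ + τ) e^{ρ t_{n−1}} t_{n−1}) Σ_{l=1}^{n} γ_l. -/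

import Mathlib

theorem le_exp_mul_of_implicit_recurrence {α β γ : ℕ → ℝ} {Δt σ τ δ : ℝ}
    (hα : ∀ n, 0 ≤ α n) (hβ : ∀ n, 0 ≤ β n) (hγ : ∀ n, 0 ≤ γ n)
    (hΔt : 0 < Δt) (hσ : 0 < σ) (hτ : 0 ≤ τ) (hδ : 0 < δ)
    (hcond : σ * Δt ≤ 1 - δ)
    (hrec : ∀ n : ℕ,
      (1 - σ * Δt) * α (n + 1) + β (n + 1) ≤ (1 + τ * Δt) * α n + γ (n + 1)) (l : ℕ) :
    α l ≤ Real.exp ((σ + τ) / δ * (l * Δt)) *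
      (α 0 + 1 / δ * ∑ i ∈ Finset.Icc 1 l, γ i) := by
  induction l with
  | zero => simp
  | succ l ih =>
    set ρ := (σ + τ) / δ with hρ
    have hρ0 : 0 ≤ ρ := by positivity
    have hρδ : ρ * δ = σ + τ := by rw [hρ]; field_simp
    have hstep : α (l + 1) ≤ (1 + ρ * Δt) * α l + 1 / δ * γ (l + 1) := by
      have hpos : 0 < 1 - σ * Δt := by linarith
      have hfactor : 1 + τ * Δt ≤ (1 - σ * Δt) * (1 + ρ * Δt) := by
        have : δ * (ρ * Δt) ≤ (1 - σ * Δt) * (ρ * Δt) := by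
          gcongr
          linarith
        linear_combination this - Δt * hρδ
      have hsource : γ (l + 1) ≤ (1 - σ * Δt) * (1 / δ * γ (l + 1)) := by
        have h := mul_le_mul_of_nonneg_right (show δ ≤ 1 - σ * Δt by linarith)
          (show 0 ≤ 1 / δ * γ (l + 1) from mul_nonneg (by positivity) (hγ _))
        rwa [← mul_assoc δ, mul_one_div_cancel hδ.ne', one_mul] at h
      refine le_of_mul_le_mul_left ?_ hpos
      linarith [hrec l, hβ (l + 1), mul_le_mul_of_nonneg_right hfactor (hα l)]
    have hexp : Real.exp (ρ * ((l + 1 : ℕ) * Δt)) =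
        Real.exp (ρ * Δt) * Real.exp (ρ * (l * Δt)) := by
      rw [← Real.exp_add]
      push_cast
      ring_nf
    have hone : 1 ≤ Real.exp (ρ * ((l + 1 : ℕ) * Δt)) := Real.one_le_exp (by positivity)
    have hsource : 0 ≤ 1 / δ * γ (l + 1) := mul_nonneg (by positivity) (hγ _)
    rw [Finset.sum_Icc_succ_top (by omega)]
    calc α (l + 1) ≤ (1 + ρ * Δt) * α l + 1 / δ * γ (l + 1) := hstep
      _ ≤ Real.exp (ρ * Δt) * (Real.exp (ρ * (l * Δt)) *
            (α 0 + 1 / δ * ∑ i ∈ Finset.Icc 1 l, γ i)) +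
          Real.exp (ρ * ((l + 1 : ℕ) * Δt)) * (1 / δ * γ (l + 1)) := by
        refine add_le_add (mul_le_mul ?_ ih (hα l) (Real.exp_nonneg _))
          (le_mul_of_one_le_left hsource hone)
        linarith [Real.add_one_le_exp (ρ * Δt)]
      _ = _ := by rw [hexp]; ring

theorem sum_add_le_of_implicit_recurrence {α β γ : ℕ → ℝ} {Δt σ τ : ℝ}
    (hrec : ∀ n : ℕ,
      (1 - σ * Δt) * α (n + 1) + β (n + 1) ≤ (1 + τ * Δt) * α n + γ (n + 1)) (m : ℕ) :
    ∑ l ∈ Finset.Icc 1 (m + 1), β l + (1 - σ * Δt) * α (m + 1) ≤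
      (1 + τ * Δt) * α 0 + (σ + τ) * Δt * ∑ l ∈ Finset.Icc 1 m, α l +
        ∑ l ∈ Finset.Icc 1 (m + 1), γ l := by
  induction m with
  | zero => simpa [add_comm] using hrec 0
  | succ m ih =>
    rw [Finset.sum_Icc_succ_top (b := m + 1) (by omega) β,
      Finset.sum_Icc_succ_top (b := m + 1) (by omega) γ,
      Finset.sum_Icc_succ_top (b := m) (by omega) α]
    linarith [hrec (m + 1)]

/-- Discrete Gronwall lemma, second estimate (estgr2): with `ρ = (σ + τ)/δ` and
`t n = n * Δt`, for every `n ≥ 1`,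
`∑_{l=1}^{n} β l ≤ (1 + τ/σ + (σ+τ) e^{ρ t_{n-1}} t_{n-1}) α 0
  + (1/δ) (1 + (σ+τ) e^{ρ t_{n-1}} t_{n-1}) ∑_{l=1}^{n} γ l`. -/
theorem discrete_gronwall_estgr2 (α β γ : ℕ → ℝ) (Δt σ τ δ : ℝ)
    (hα : ∀ n, 0 ≤ α n) (hβ : ∀ n, 0 ≤ β n) (hγ : ∀ n, 0 ≤ γ n)
    (hΔt : 0 < Δt) (hσ : 0 < σ) (hτ : 0 ≤ τ) (hδ : 0 < δ)
    (hcond : σ * Δt ≤ 1 - δ)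
    (hrec : ∀ n : ℕ,
      (1 - σ * Δt) * α (n + 1) + β (n + 1) ≤ (1 + τ * Δt) * α n + γ (n + 1)) :
    ∀ n : ℕ, 1 ≤ n →
      ∑ l ∈ Finset.Icc 1 n, β l ≤
        (1 + τ / σ +
            (σ + τ) * Real.exp (((σ + τ) / δ) * (((n : ℝ) - 1) * Δt)) *
              (((n : ℝ) - 1) * Δt)) * α 0 +
        (1 / δ) *
          (1 + (σ + τ) * Real.exp (((σ + τ) / δ) * (((n : ℝ) - 1) * Δt)) *
              (((n : ℝ) - 1) * Δt)) *
          ∑ l ∈ Finset.Icc 1 n, γ l := by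
  intro n hn
  obtain ⟨m, rfl⟩ := Nat.exists_eq_add_of_le' hn
  have hm : ((m + 1 : ℕ) : ℝ) - 1 = m := by push_cast; ring
  rw [hm]
  set G := ∑ l ∈ Finset.Icc 1 (m + 1), γ l with hG
  set E := Real.exp ((σ + τ) / δ * (m * Δt)) with hE
  have hG0 : 0 ≤ G := Finset.sum_nonneg fun i _ => hγ i
  have hσΔt : 0 < σ * Δt := by positivity
  have hsum : ∑ l ∈ Finset.Icc 1 m, α l ≤ m * (E * (α 0 + 1 / δ * G)) := by
    have h : ∀ l ∈ Finset.Icc 1 m, α l ≤ E * (α 0 + 1 / δ * G) := by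
      intro l hl
      have hlm : l ≤ m := (Finset.mem_Icc.mp hl).2
      refine (le_exp_mul_of_implicit_recurrence hα hβ hγ hΔt hσ hτ hδ hcond hrec l).trans ?_
      have hγsum : ∑ i ∈ Finset.Icc 1 l, γ i ≤ G :=
        Finset.sum_le_sum_of_subset_of_nonneg
          (Finset.Icc_subset_Icc_right (by omega)) fun i _ _ => hγ i
      have hγ0 : 0 ≤ ∑ i ∈ Finset.Icc 1 l, γ i := Finset.sum_nonneg fun i _ => hγ i
      have hα0 := hα 0
      rw [hE]
      gcongr
    simpa using Finset.sum_le_card_nsmul _ _ _ h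
  have hinit : (1 + τ * Δt) * α 0 ≤ (1 + τ / σ) * α 0 := by
    refine mul_le_mul_of_nonneg_right ?_ (hα 0)
    rw [div_eq_mul_one_div]
    have : Δt ≤ 1 / σ := by
      rw [le_div_iff₀ hσ]
      linarith
    gcongr
  have hsource : G ≤ 1 / δ * G :=
    le_mul_of_one_le_left hG0 (by rw [le_div_iff₀ hδ]; linarith)
  have hlast : 0 ≤ (1 - σ * Δt) * α (m + 1) := mul_nonneg (by linarith) (hα _)
  have hscaled := mul_le_mul_of_nonneg_left hsum (show 0 ≤ (σ + τ) * Δt by positivity)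
  linarith [sum_add_le_of_implicit_recurrence hrec m]
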